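/- (Mid-frequency energy estimate connecting the high- and low-frequency regimes.) Let τ̊ ≥ 1 be as in the coercivity of the high-frequency Einstein energy, and define the mid-frequency energy E_mid(t) := ∑_{i,j} t^{−2p_i+2p_j}·((κ_i{}^j(t))² + (η_i{}^j(t))²) + ψ(t)² + φ(t)². Let λ ∈ ℤ^D \ {0} and let (η, κ, φ, ψ, ν, X) be a λ-mode CMCSH solution of the linearized Einstein–scalar field system on (0,∞); let t_{τ̊} be the unique time with τ(t_{τ̊}) = τ̊ (so t_{τ̊} ≥ t_{λ*}). Then there is C_mid > 0 depending only on D, p_1,…,p_D, p_φ such that: (i) for every t with 1 ≤ τ(t) ≤ τ̊: C_mid^{−1}·E_mid(t) ≤ E_mid(t_{τ̊}) ≤ C_mid·E_mid(t); (ii) C_mid^{−1}·E_mid(t_{λ*}) ≤ E_high(t_{τ̊}) ≤ C_mid·E_mid(t_{λ*}). (Note that E_mid(t_{λ*}) equals the low-frequency energy at t = t_{λ*}, since the renormalized quantities coincide with η and φ there.) -/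

import Mathlib

open Real Filter MeasureTheory Topology

/-- τ_λ(t) = (∑ᵢ t^(2-2pᵢ) λᵢ²)^(1/2). -/
noncomputable def tau {D : ℕ} (p : Fin D → ℝ) (lam : Fin D → ℤ) (t : ℝ) : ℝ :=
  Real.sqrt (∑ i, t ^ (2 - 2 * p i) * ((lam i : ℝ)) ^ 2)

/-- ζ_λ(t) = 2τ_λ(t)² / ∑ᵢ (2-2pᵢ) t^(2-2pᵢ) λᵢ². -/
noncomputable def zeta {D : ℕ} (p : Fin D → ℝ) (lam : Fin D → ℤ) (t : ℝ) : ℝ :=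
  2 * tau p lam t ^ 2 / ∑ i, (2 - 2 * p i) * t ^ (2 - 2 * p i) * ((lam i : ℝ)) ^ 2

/-- A λ-mode CMCSH solution of the linearized Einstein–scalar field system on (0,∞):
the real form of the projection of the linearized system in the
constant-mean-curvature spatially-harmonic gauge onto the Fourier mode λ
(the Fourier coefficient of the shift being χ^j = i·X^j). -/
structure IsCMCSHSolution {D : ℕ} (p : Fin D → ℝ) (pphi : ℝ) (lam : Fin D → ℤ)
    (η κ : ℝ → Fin D → Fin D → ℝ) (φ ψ ν : ℝ → ℝ) (X : ℝ → Fin D → ℝ) : Prop where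
  cont_nu : ContinuousOn ν (Set.Ioi 0)
  cont_X : ∀ j, ContinuousOn (fun t => X t j) (Set.Ioi 0)
  eta_evol : ∀ t ∈ Set.Ioi (0:ℝ), ∀ i j, HasDerivAt (fun s => η s i j)
    ((κ t i j + 2 * (p i - p j) * η t i j - p i * (if i = j then 1 else 0) * ν t
      - (1/2) * (lam i : ℝ) * X t j
      - (1/2) * t ^ (2 * p i - 2 * p j) * (lam j : ℝ) * X t i) / t) t
  kappa_evol : ∀ t ∈ Set.Ioi (0:ℝ), ∀ i j, HasDerivAt (fun s => κ s i j)
    ((-(tau p lam t ^ 2) * η t i j + t ^ (2 - 2 * p j) * (lam i : ℝ) * (lam j : ℝ) * ν t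
      + p i * (if i = j then 1 else 0) * ν t + (p i - p j) * (lam i : ℝ) * X t j) / t) t
  phi_evol : ∀ t ∈ Set.Ioi (0:ℝ), HasDerivAt φ ((ψ t + pphi * ν t) / t) t
  psi_evol : ∀ t ∈ Set.Ioi (0:ℝ), HasDerivAt ψ ((-(tau p lam t ^ 2) * φ t - pphi * ν t) / t) t
  nu_elliptic : ∀ t ∈ Set.Ioi (0:ℝ),
    (1 + tau p lam t ^ 2) * ν t = tau p lam t ^ 2 * ∑ a, η t a a
  X_elliptic : ∀ t ∈ Set.Ioi (0:ℝ), ∀ j, tau p lam t ^ 2 * X t j =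
    (1 - 2 * p j) * t ^ (2 - 2 * p j) * (lam j : ℝ) * ν t
      - 4 * ∑ q, p q * t ^ (2 - 2 * p q) * (lam q : ℝ) * η t q j
      + 2 * t ^ (2 - 2 * p j) * (lam j : ℝ) * ((∑ a, p a * η t a a) - 2 * pphi * φ t)
  cmc : ∀ t ∈ Set.Ioi (0:ℝ), ∑ a, κ t a a = 0
  sh_gauge : ∀ t ∈ Set.Ioi (0:ℝ), ∀ i,
    2 * ∑ j, (lam j : ℝ) * η t i j = (lam i : ℝ) * ∑ a, η t a a
  hamiltonian : ∀ t ∈ Set.Ioi (0:ℝ),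
    tau p lam t ^ 2 * (∑ a, η t a a) - 2 * (∑ a, p a * κ t a a) + 4 * pphi * ψ t = 0
  momentum : ∀ t ∈ Set.Ioi (0:ℝ), ∀ i,
    (∑ j, (lam j : ℝ) * κ t i j)
      + (lam i : ℝ) * (-(∑ a, p a * η t a a) + 2 * pphi * φ t)
      + p i * (lam i : ℝ) * (∑ a, η t a a) = 0
  sym_eta : ∀ t ∈ Set.Ioi (0:ℝ), ∀ a c,
    t ^ (-(2 * p a)) * η t a c = t ^ (-(2 * p c)) * η t c a
  sym_kappa : ∀ t ∈ Set.Ioi (0:ℝ), ∀ a c,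
    t ^ (-(2 * p a)) * (κ t a c + 2 * p a * η t a c)
      = t ^ (-(2 * p c)) * (κ t c a + 2 * p c * η t c a)

/-- The total high-frequency energy E_high = E_{η,high} + E_{φ,high} of a λ-mode solution. -/
noncomputable def EsysHigh {D : ℕ} (p : Fin D → ℝ) (lam : Fin D → ℤ)
    (η κ : ℝ → Fin D → Fin D → ℝ) (φ ψ : ℝ → ℝ) (t : ℝ) : ℝ :=
  (zeta p lam t ^ 2 / tau p lam t * (∑ i, ∑ j, κ t i j * κ t j i)
    + zeta p lam t / tau p lam t * (∑ i, ∑ j, κ t i j * η t j i)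
    + (1 / (2 * tau p lam t) + zeta p lam t ^ 2 * tau p lam t) * (∑ i, ∑ j, η t i j * η t j i))
  + (zeta p lam t ^ 2 / tau p lam t * ψ t ^ 2 + zeta p lam t / tau p lam t * ψ t * φ t
    + (1 / (2 * tau p lam t) + zeta p lam t ^ 2 * tau p lam t) * φ t ^ 2)

/-- The mid-frequency energy E_mid(t). -/
noncomputable def Emid {D : ℕ} (p : Fin D → ℝ)
    (η κ : ℝ → Fin D → Fin D → ℝ) (φ ψ : ℝ → ℝ) (t : ℝ) : ℝ :=
  (∑ i, ∑ j, t ^ (-(2 * p i) + 2 * p j) * ((κ t i j) ^ 2 + (η t i j) ^ 2))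
    + ψ t ^ 2 + φ t ^ 2

/-- The components of a mixed tensor in the frame orthonormal for the Kasner background. -/
noncomputable def kasnerFrame {D : ℕ} (p : Fin D → ℝ) (M : ℝ → Fin D → Fin D → ℝ) (t : ℝ)
    (i j : Fin D) : ℝ :=
  t ^ (p j - p i) * M t i j

theorem abs_mul_le_mul_of_abs_le {x y a b : ℝ} (hx : |x| ≤ a) (hy : |y| ≤ b) :
    |x * y| ≤ a * b := by
  rw [abs_mul]
  exact mul_le_mul hx hy (abs_nonneg _) ((abs_nonneg _).trans hx)

theorem abs_sum_fin_le {D : ℕ} {f : Fin D → ℝ} {B : ℝ} (hf : ∀ i, |f i| ≤ B) :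
    |∑ i, f i| ≤ D * B := by
  refine (Finset.abs_sum_le_sum_abs _ _).trans ?_
  refine (Finset.sum_le_sum fun i _ => hf i).trans ?_
  simp

theorem hasDerivAt_rpow_mul {f : ℝ → ℝ} {g t w : ℝ} (ht : 0 < t)
    (hf : HasDerivAt f (g / t) t) :
    HasDerivAt (fun s => s ^ w * f s) ((w * (t ^ w * f t) + t ^ w * g) / t) t := by
  have h := (Real.hasDerivAt_rpow_const (x := t) (p := w) (Or.inl ht.ne')).mul hf
  rw [Real.rpow_sub_one ht.ne'] at h
  refine h.congr_deriv ?_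
  field_simp

/-- A Grönwall estimate in logarithmic time. -/
theorem le_rpow_mul_of_abs_deriv_le {f g : ℝ → ℝ} {C a b : ℝ} (ha : 0 < a) (hab : a ≤ b)
    (hf : ∀ t ∈ Set.Icc a b, HasDerivAt f (g t / t) t)
    (hg : ∀ t ∈ Set.Icc a b, |g t| ≤ C * f t) :
    f b ≤ (b / a) ^ C * f a ∧ f a ≤ (b / a) ^ C * f b := by
  have hb : 0 < b := ha.trans_le hab
  have hd : ∀ w, ∀ t ∈ Set.Icc a b,
      HasDerivAt (fun s => s ^ w * f s) ((w * (t ^ w * f t) + t ^ w * g t) / t) t :=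
    fun w t ht => hasDerivAt_rpow_mul (ha.trans_le ht.1) (hf t ht)
  have hmono : MonotoneOn (fun s => s ^ C * f s) (Set.Icc a b) := by
    refine monotoneOn_of_hasDerivWithinAt_nonneg (convex_Icc a b)
      (fun t ht => (hd C t ht).continuousAt.continuousWithinAt)
      (fun t ht => (hd C t (interior_subset ht)).hasDerivWithinAt) fun t ht => ?_
    have ht' := interior_subset ht
    have htp : 0 < t := ha.trans_le ht'.1
    have h1 := (abs_le.1 (hg t ht')).1
    have h2 : 0 ≤ t ^ C * (C * f t + g t) :=
      mul_nonneg (Real.rpow_nonneg htp.le _) (by linarith)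
    exact div_nonneg (by linarith) htp.le
  have hanti : AntitoneOn (fun s => s ^ (-C) * f s) (Set.Icc a b) := by
    refine antitoneOn_of_hasDerivWithinAt_nonpos (convex_Icc a b)
      (fun t ht => (hd (-C) t ht).continuousAt.continuousWithinAt)
      (fun t ht => (hd (-C) t (interior_subset ht)).hasDerivWithinAt) fun t ht => ?_
    have ht' := interior_subset ht
    have htp : 0 < t := ha.trans_le ht'.1
    have h1 := (abs_le.1 (hg t ht')).2
    have h2 : 0 ≤ t ^ (-C) * (C * f t - g t) :=
      mul_nonneg (Real.rpow_nonneg htp.le _) (by linarith)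
    exact div_nonpos_of_nonpos_of_nonneg (by linarith) htp.le
  have hm := hmono (Set.left_mem_Icc.2 hab) (Set.right_mem_Icc.2 hab) hab
  have hn := hanti (Set.left_mem_Icc.2 hab) (Set.right_mem_Icc.2 hab) hab
  simp only [Real.rpow_neg ha.le, Real.rpow_neg hb.le] at hm hn
  have hA := Real.rpow_pos_of_pos ha C
  have hB := Real.rpow_pos_of_pos hb C
  rw [Real.div_rpow hb.le ha.le]
  constructor
  · rw [inv_mul_le_iff₀ hB] at hn
    linarith [show b ^ C * ((a ^ C)⁻¹ * f a) = b ^ C / a ^ C * f a by ring]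
  · rw [div_mul_eq_mul_div, le_div_iff₀ hA]
    linarith

theorem tau_sq {D : ℕ} (p : Fin D → ℝ) (lam : Fin D → ℤ) {t : ℝ} (ht : 0 < t) :
    tau p lam t ^ 2 = ∑ i, t ^ (2 - 2 * p i) * (lam i : ℝ) ^ 2 :=
  Real.sq_sqrt (Finset.sum_nonneg fun i _ => by positivity)

theorem rpow_mul_tau_sq_le {D : ℕ} {p : Fin D → ℝ} {c : ℝ} (hc : ∀ i, p i ≤ 1 - c)
    (lam : Fin D → ℤ) {a b : ℝ} (ha : 0 < a) (hab : a ≤ b) :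
    (b / a) ^ (2 * c) * tau p lam a ^ 2 ≤ tau p lam b ^ 2 := by
  have hb := ha.trans_le hab
  rw [tau_sq p lam ha, tau_sq p lam hb, Finset.mul_sum]
  refine Finset.sum_le_sum fun i _ => ?_
  rw [← mul_assoc]
  refine mul_le_mul_of_nonneg_right ?_ (sq_nonneg _)
  calc (b / a) ^ (2 * c) * a ^ (2 - 2 * p i)
      ≤ (b / a) ^ (2 - 2 * p i) * a ^ (2 - 2 * p i) := by
        refine mul_le_mul_of_nonneg_right ?_ (by positivity)
        exact Real.rpow_le_rpow_of_exponent_le ((one_le_div ha).2 hab) (by linarith [hc i])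
    _ = b ^ (2 - 2 * p i) := by
        rw [← Real.mul_rpow (by positivity) ha.le, div_mul_cancel₀ _ ha.ne']

theorem tau_le_tau {D : ℕ} {p : Fin D → ℝ} (hp : ∀ i, p i ≤ 1) (lam : Fin D → ℤ) {a b : ℝ}
    (ha : 0 < a) (hab : a ≤ b) : tau p lam a ≤ tau p lam b := by
  have h := rpow_mul_tau_sq_le (c := 0) (fun i => by simpa using hp i) lam ha hab
  simp only [mul_zero, Real.rpow_zero, one_mul] at h
  exact (sq_le_sq₀ (Real.sqrt_nonneg _) (Real.sqrt_nonneg _)).1 h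

theorem zeta_bounds {D : ℕ} {p : Fin D → ℝ} {c : ℝ} (hc0 : 0 < c) (hc : ∀ i, p i ≤ 1 - c)
    (hp : ∀ i, |p i| ≤ 1) (lam : Fin D → ℤ) {t : ℝ} (ht : 0 < t) (hτ : 0 < tau p lam t) :
    1 / 2 ≤ zeta p lam t ∧ zeta p lam t ≤ 1 / c := by
  have hτ2 : 0 < tau p lam t ^ 2 := by positivity
  have hlow : 2 * c * tau p lam t ^ 2
      ≤ ∑ i, (2 - 2 * p i) * t ^ (2 - 2 * p i) * (lam i : ℝ) ^ 2 := by
    rw [tau_sq p lam ht, Finset.mul_sum]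
    refine Finset.sum_le_sum fun i _ => ?_
    rw [mul_assoc (2 - 2 * p i)]
    exact mul_le_mul_of_nonneg_right (by linarith [hc i]) (by positivity)
  have hup : ∑ i, (2 - 2 * p i) * t ^ (2 - 2 * p i) * (lam i : ℝ) ^ 2
      ≤ 4 * tau p lam t ^ 2 := by
    rw [tau_sq p lam ht, Finset.mul_sum]
    refine Finset.sum_le_sum fun i _ => ?_
    rw [mul_assoc (2 - 2 * p i)]
    exact mul_le_mul_of_nonneg_right (by linarith [(abs_le.1 (hp i)).1]) (by positivity)
  have hpos : 0 < ∑ i, (2 - 2 * p i) * t ^ (2 - 2 * p i) * (lam i : ℝ) ^ 2 :=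
    lt_of_lt_of_le (by positivity) hlow
  unfold zeta
  constructor
  · rw [le_div_iff₀ hpos]; linarith
  · rw [div_le_div_iff₀ hpos hc0]; linarith

/-- Pointwise coercivity of the quadratic form defining the high-frequency energy at `τ = 4`. -/
theorem high_form_bounds {z Z d : ℝ} (hz : 1 / 2 ≤ z) (hZ : z ≤ Z) (hd : |d| ≤ 2) (x y : ℝ) :
    1 / 64 * (x ^ 2 + y ^ 2)
        ≤ z ^ 2 / 4 * (x * (x + 2 * d * y)) + z / 4 * (x * y)
          + (1 / (2 * 4) + z ^ 2 * 4) * y ^ 2 ∧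
      z ^ 2 / 4 * (x * (x + 2 * d * y)) + z / 4 * (x * y)
          + (1 / (2 * 4) + z ^ 2 * 4) * y ^ 2
        ≤ (10 * Z ^ 2 + 1) * (x ^ 2 + y ^ 2) := by
  have hz2 : 1 / 4 ≤ z ^ 2 := by nlinarith
  have hZ2 : z ^ 2 ≤ Z ^ 2 := by nlinarith
  have hd2 : d ^ 2 ≤ 4 := by nlinarith [abs_le.1 hd, sq_abs d, abs_nonneg d]
  have hlow : -(x ^ 2 / 2 + 8 * y ^ 2) ≤ 2 * d * (x * y) := by
    nlinarith [sq_nonneg (x + 2 * d * y), mul_le_mul_of_nonneg_right hd2 (sq_nonneg y)]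
  have hupp : 2 * d * (x * y) ≤ x ^ 2 / 2 + 8 * y ^ 2 := by
    nlinarith [sq_nonneg (x - 2 * d * y), mul_le_mul_of_nonneg_right hd2 (sq_nonneg y)]
  have h1 := mul_le_mul_of_nonneg_left hlow (sq_nonneg z)
  have h2 := mul_le_mul_of_nonneg_left hupp (sq_nonneg z)
  have h3 := mul_le_mul_of_nonneg_right hz2 (sq_nonneg x)
  have h4 := mul_le_mul_of_nonneg_right hz2 (sq_nonneg y)
  have h5 := mul_le_mul_of_nonneg_right hZ2 (sq_nonneg x)
  have h6 := mul_le_mul_of_nonneg_right hZ2 (sq_nonneg y)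
  constructor
  · nlinarith [sq_nonneg (z * x / 2 + y)]
  · nlinarith [sq_nonneg (z * x / 2 - y)]

section Solution

variable {D : ℕ} {p : Fin D → ℝ} {pphi : ℝ} {lam : Fin D → ℤ}
  {η κ : ℝ → Fin D → Fin D → ℝ} {φ ψ ν : ℝ → ℝ} {X : ℝ → Fin D → ℝ}

theorem Emid_eq_kasnerFrame {t : ℝ} (ht : 0 < t) :
    Emid p η κ φ ψ t = (∑ i, ∑ j, (kasnerFrame p κ t i j ^ 2 + kasnerFrame p η t i j ^ 2))
      + ψ t ^ 2 + φ t ^ 2 := by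
  unfold Emid kasnerFrame
  congr 2
  refine Finset.sum_congr rfl fun i _ => Finset.sum_congr rfl fun j _ => ?_
  rw [show -(2 * p i) + 2 * p j = (p j - p i) + (p j - p i) by ring, Real.rpow_add ht]
  ring

theorem Emid_nonneg {t : ℝ} (ht : 0 < t) : 0 ≤ Emid p η κ φ ψ t := by
  rw [Emid_eq_kasnerFrame ht]; positivity

theorem kasnerFrame_mul_kasnerFrame_swap (M N : ℝ → Fin D → Fin D → ℝ) {t : ℝ} (ht : 0 < t)
    (i j : Fin D) : kasnerFrame p M t i j * kasnerFrame p N t j i = M t i j * N t j i := by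
  have h : t ^ (p j - p i) * t ^ (p i - p j) = 1 := by
    rw [← Real.rpow_add ht]; simp
  unfold kasnerFrame
  linear_combination (M t i j * N t j i) * h

theorem IsCMCSHSolution.kasnerFrame_eta_swap (h : IsCMCSHSolution p pphi lam η κ φ ψ ν X)
    {t : ℝ} (ht : 0 < t) (i j : Fin D) :
    kasnerFrame p η t j i = kasnerFrame p η t i j := by
  have hs := h.sym_eta t ht i j
  have hw : ∀ k l, t ^ (p l - p k) = t ^ (p k + p l) * t ^ (-(2 * p k)) := fun k l => by
    rw [← Real.rpow_add ht]; ring_nf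
  unfold kasnerFrame
  rw [hw i j, hw j i, add_comm (p j)]
  linear_combination -t ^ (p i + p j) * hs

theorem IsCMCSHSolution.kasnerFrame_kappa_swap (h : IsCMCSHSolution p pphi lam η κ φ ψ ν X)
    {t : ℝ} (ht : 0 < t) (i j : Fin D) :
    kasnerFrame p κ t j i
      = kasnerFrame p κ t i j + 2 * (p i - p j) * kasnerFrame p η t i j := by
  have hs := h.sym_kappa t ht i j
  have he := h.kasnerFrame_eta_swap ht i j
  have hw : ∀ k l, t ^ (p l - p k) = t ^ (p k + p l) * t ^ (-(2 * p k)) := fun k l => by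
    rw [← Real.rpow_add ht]; ring_nf
  unfold kasnerFrame at he ⊢
  rw [hw i j, hw j i, add_comm (p j)] at he ⊢
  linear_combination -t ^ (p i + p j) * hs - 2 * p j * he

theorem IsCMCSHSolution.EsysHigh_bounds (h : IsCMCSHSolution p pphi lam η κ φ ψ ν X)
    (hp : ∀ i, |p i| ≤ 1) {c : ℝ} (hc0 : 0 < c) (hc : ∀ i, p i ≤ 1 - c)
    {t : ℝ} (ht : 0 < t) (hτ : tau p lam t = 4) :
    1 / 64 * Emid p η κ φ ψ t ≤ EsysHigh p lam η κ φ ψ t ∧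
      EsysHigh p lam η κ φ ψ t ≤ (10 * (1 / c) ^ 2 + 1) * Emid p η κ φ ψ t := by
  obtain ⟨hz1, hz2⟩ := zeta_bounds hc0 hc hp lam ht (by rw [hτ]; norm_num)
  set z := zeta p lam t with hz
  have hd : ∀ i j, |p i - p j| ≤ 2 := fun i j => by
    linarith [abs_sub (p i) (p j), hp i, hp j]
  have hE : EsysHigh p lam η κ φ ψ t =
      (∑ i, ∑ j, (z ^ 2 / 4 * (kasnerFrame p κ t i j *
          (kasnerFrame p κ t i j + 2 * (p i - p j) * kasnerFrame p η t i j))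
        + z / 4 * (kasnerFrame p κ t i j * kasnerFrame p η t i j)
        + (1 / (2 * 4) + z ^ 2 * 4) * kasnerFrame p η t i j ^ 2))
      + (z ^ 2 / 4 * (ψ t * (ψ t + 2 * 0 * φ t)) + z / 4 * (ψ t * φ t)
        + (1 / (2 * 4) + z ^ 2 * 4) * φ t ^ 2) := by
    unfold EsysHigh
    rw [hτ, ← hz]
    congr 1
    · simp only [Finset.mul_sum, ← Finset.sum_add_distrib]
      refine Finset.sum_congr rfl fun i _ => Finset.sum_congr rfl fun j _ => ?_
      rw [← h.kasnerFrame_kappa_swap ht, kasnerFrame_mul_kasnerFrame_swap κ κ ht,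
        ← kasnerFrame_mul_kasnerFrame_swap κ η ht, ← kasnerFrame_mul_kasnerFrame_swap η η ht,
        h.kasnerFrame_eta_swap ht i j]
      ring
    · ring
  have hscal := high_form_bounds hz1 hz2 (d := 0) (by norm_num) (ψ t) (φ t)
  have hten := fun i j =>
    high_form_bounds hz1 hz2 (hd i j) (kasnerFrame p κ t i j) (kasnerFrame p η t i j)
  have hlow := Finset.sum_le_sum (s := Finset.univ) fun i _ =>
    Finset.sum_le_sum (s := Finset.univ) fun j _ => (hten i j).1
  have hupp := Finset.sum_le_sum (s := Finset.univ) fun i _ =>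
    Finset.sum_le_sum (s := Finset.univ) fun j _ => (hten i j).2
  simp only [← Finset.mul_sum] at hlow hupp
  rw [hE, Emid_eq_kasnerFrame ht]
  constructor
  · linarith [hscal.1]
  · linarith [hscal.2]

/-- The bounds of all frame components by the square root of the energy. -/
theorem abs_le_sqrt_Emid {t : ℝ} (ht : 0 < t) :
    (∀ i j, |kasnerFrame p κ t i j| ≤ √(Emid p η κ φ ψ t)) ∧
    (∀ i j, |kasnerFrame p η t i j| ≤ √(Emid p η κ φ ψ t)) ∧
    |ψ t| ≤ √(Emid p η κ φ ψ t) ∧ |φ t| ≤ √(Emid p η κ φ ψ t) := by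
  have hsum : ∀ i j, kasnerFrame p κ t i j ^ 2 + kasnerFrame p η t i j ^ 2
      ≤ ∑ i, ∑ j, (kasnerFrame p κ t i j ^ 2 + kasnerFrame p η t i j ^ 2) := fun i j =>
    (Finset.single_le_sum (f := fun j => kasnerFrame p κ t i j ^ 2 + kasnerFrame p η t i j ^ 2)
      (fun _ _ => by positivity) (Finset.mem_univ j)).trans
    (Finset.single_le_sum
      (f := fun i => ∑ j, (kasnerFrame p κ t i j ^ 2 + kasnerFrame p η t i j ^ 2))
      (fun _ _ => by positivity) (Finset.mem_univ i))
  have hsum0 : 0 ≤ ∑ i, ∑ j, (kasnerFrame p κ t i j ^ 2 + kasnerFrame p η t i j ^ 2) := by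
    positivity
  rw [Emid_eq_kasnerFrame ht]
  refine ⟨fun i j => ?_, fun i j => ?_, ?_, ?_⟩ <;> apply Real.abs_le_sqrt
  · nlinarith [hsum i j, sq_nonneg (ψ t), sq_nonneg (φ t), sq_nonneg (kasnerFrame p η t i j)]
  · nlinarith [hsum i j, sq_nonneg (ψ t), sq_nonneg (φ t), sq_nonneg (kasnerFrame p κ t i j)]
  · nlinarith [sq_nonneg (ψ t), sq_nonneg (φ t)]
  · nlinarith [sq_nonneg (ψ t), sq_nonneg (φ t)]

theorem abs_rpow_mul_lam_le {t : ℝ} (ht : 0 < t) (hτ : tau p lam t ≤ 4) (i : Fin D) :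
    |t ^ (1 - p i) * (lam i : ℝ)| ≤ 4 := by
  refine le_trans (Real.abs_le_sqrt ?_) hτ
  refine le_trans (le_of_eq ?_) (Finset.single_le_sum
    (f := fun i => t ^ (2 - 2 * p i) * (lam i : ℝ) ^ 2) (fun _ _ => by positivity)
    (Finset.mem_univ i))
  rw [show 2 - 2 * p i = (1 - p i) + (1 - p i) by ring, Real.rpow_add ht]
  ring

theorem IsCMCSHSolution.abs_nu_le (h : IsCMCSHSolution p pphi lam η κ φ ψ ν X)
    {t : ℝ} (ht : 0 < t) : |ν t| ≤ |∑ a, η t a a| := by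
  have hν := congrArg abs (h.nu_elliptic t ht)
  rw [abs_mul, abs_mul, abs_of_nonneg (by positivity : 0 ≤ 1 + tau p lam t ^ 2),
    abs_of_nonneg (sq_nonneg (tau p lam t))] at hν
  nlinarith [sq_nonneg (tau p lam t), abs_nonneg (ν t), abs_nonneg (∑ a, η t a a)]

theorem IsCMCSHSolution.abs_shift_le (h : IsCMCSHSolution p pphi lam η κ φ ψ ν X)
    (hp : ∀ i, |p i| ≤ 1) (hpphi : |pphi| ≤ 1) {t S : ℝ} (ht : 0 < t)
    (hτ1 : 1 ≤ tau p lam t) (hτ4 : tau p lam t ≤ 4)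
    (hη : ∀ i j, |kasnerFrame p η t i j| ≤ S) (hφ : |φ t| ≤ S) (hν : |ν t| ≤ D * S)
    (j : Fin D) : |t ^ (p j - 1) * X t j| ≤ (36 * D + 16) * S := by
  have hS : 0 ≤ S := (abs_nonneg _).trans hφ
  have hl := abs_rpow_mul_lam_le (p := p) (lam := lam) ht hτ4
  have hX : tau p lam t ^ 2 * (t ^ (p j - 1) * X t j)
      = (1 - 2 * p j) * ((t ^ (1 - p j) * (lam j : ℝ)) * ν t)
        - 4 * (∑ q, p q * ((t ^ (1 - p q) * (lam q : ℝ)) * kasnerFrame p η t q j))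
        + 2 * ((t ^ (1 - p j) * (lam j : ℝ))
          * ((∑ a, p a * kasnerFrame p η t a a) - 2 * (pphi * φ t))) := by
    have hX := h.X_elliptic t ht j
    have h1 : t ^ (p j - 1) * t ^ (2 - 2 * p j) = t ^ (1 - p j) := by
      rw [← Real.rpow_add ht]; ring_nf
    have h2 : t ^ (p j - 1) * ∑ q, p q * t ^ (2 - 2 * p q) * (lam q : ℝ) * η t q j
        = ∑ q, p q * ((t ^ (1 - p q) * (lam q : ℝ)) * kasnerFrame p η t q j) := by
      rw [Finset.mul_sum]
      refine Finset.sum_congr rfl fun q _ => ?_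
      have h3 : t ^ (p j - 1) * t ^ (2 - 2 * p q) = t ^ (1 - p q) * t ^ (p j - p q) := by
        rw [← Real.rpow_add ht, ← Real.rpow_add ht]; ring_nf
      unfold kasnerFrame
      linear_combination (p q * lam q * η t q j) * h3
    have h4 : ∑ a, p a * kasnerFrame p η t a a = ∑ a, p a * η t a a := by
      simp [kasnerFrame]
    rw [← h2, h4]
    linear_combination t ^ (p j - 1) * hX
      + ((1 - 2 * p j) * lam j * ν t
        + 2 * lam j * ((∑ a, p a * η t a a) - 2 * pphi * φ t)) * h1
  have hb1 : |(1 - 2 * p j) * ((t ^ (1 - p j) * (lam j : ℝ)) * ν t)| ≤ 3 * (4 * (D * S)) := by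
    refine abs_mul_le_mul_of_abs_le ?_ (abs_mul_le_mul_of_abs_le (hl j) hν)
    have := abs_le.1 (hp j)
    exact abs_le.2 ⟨by linarith, by linarith⟩
  have hb2 : |∑ q, p q * ((t ^ (1 - p q) * (lam q : ℝ)) * kasnerFrame p η t q j)|
      ≤ D * (1 * (4 * S)) :=
    abs_sum_fin_le fun q =>
      abs_mul_le_mul_of_abs_le (hp q) (abs_mul_le_mul_of_abs_le (hl q) (hη q j))
  have hb3 : |∑ a, p a * kasnerFrame p η t a a| ≤ D * (1 * S) :=
    abs_sum_fin_le fun a => abs_mul_le_mul_of_abs_le (hp a) (hη a a)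
  have hb4 : |pphi * φ t| ≤ 1 * S := abs_mul_le_mul_of_abs_le hpphi hφ
  have hb5 : |(∑ a, p a * kasnerFrame p η t a a) - 2 * (pphi * φ t)| ≤ D * S + 2 * S := by
    rw [abs_le] at *
    constructor <;> linarith [hb3.1, hb3.2, hb4.1, hb4.2]
  have hb6 := abs_mul_le_mul_of_abs_le (hl j) hb5
  have hτX : |tau p lam t ^ 2 * (t ^ (p j - 1) * X t j)| ≤ (36 * D + 16) * S := by
    rw [hX]
    rw [abs_le] at hb1 hb2 hb6 ⊢
    constructor <;> linarith [hb1.1, hb1.2, hb2.1, hb2.2, hb6.1, hb6.2]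
  rw [abs_mul, abs_of_nonneg (sq_nonneg (tau p lam t))] at hτX
  refine le_trans ?_ hτX
  exact le_mul_of_one_le_left (abs_nonneg _) (by nlinarith)

/-- The linear-in-energy bound on the logarithmic time derivative of the mid-frequency energy. -/
theorem IsCMCSHSolution.exists_deriv_Emid (h : IsCMCSHSolution p pphi lam η κ φ ψ ν X)
    (hp : ∀ i, |p i| ≤ 1) (hpphi : |pphi| ≤ 1) {t : ℝ} (ht : 0 < t)
    (hτ1 : 1 ≤ tau p lam t) (hτ4 : tau p lam t ≤ 4) :
    ∃ G, HasDerivAt (Emid p η κ φ ψ) (G / t) t ∧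
      |G| ≤ (4 * D ^ 2 + 4) * (305 * D + 146) * Emid p η κ φ ψ t := by
  obtain ⟨hκ, hη, hψ, hφ⟩ := abs_le_sqrt_Emid (p := p) (η := η) (κ := κ) (φ := φ) (ψ := ψ) ht
  set S := √(Emid p η κ φ ψ t) with hSdef
  have hSS : S * S = Emid p η κ φ ψ t := Real.mul_self_sqrt (Emid_nonneg ht)
  have hS : 0 ≤ S := Real.sqrt_nonneg _
  have hD0 : (0 : ℝ) ≤ D := Nat.cast_nonneg D
  have hDS : 0 ≤ D * S := mul_nonneg hD0 hS
  have hν : |ν t| ≤ D * S := by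
    refine (h.abs_nu_le ht).trans (abs_sum_fin_le fun a => ?_)
    simpa [kasnerFrame] using hη a a
  have hX := h.abs_shift_le hp hpphi ht hτ1 hτ4 hη hφ hν
  have hl := abs_rpow_mul_lam_le (p := p) (lam := lam) ht hτ4
  have hτsq : |tau p lam t ^ 2| ≤ 16 := by
    rw [abs_of_nonneg (sq_nonneg _)]; nlinarith
  have hd : ∀ i j, |p i - p j| ≤ 2 := fun i j => by
    linarith [abs_sub (p i) (p j), hp i, hp j]
  have hδ : ∀ i j : Fin D, |p i * (if i = j then 1 else 0) * ν t| ≤ 1 * (D * S) := fun i j => by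
    refine abs_mul_le_mul_of_abs_le ?_ hν
    split_ifs <;> simp [hp i]
  have hδw : ∀ i j : Fin D, t ^ (p j - p i) * (p i * (if i = j then 1 else 0) * ν t)
      = p i * (if i = j then 1 else 0) * ν t := fun i j => by
    split_ifs with hij
    · simp [hij]
    · simp
  have hlX : ∀ i j, |(t ^ (1 - p i) * (lam i : ℝ)) * (t ^ (p j - 1) * X t j)|
      ≤ 4 * ((36 * D + 16) * S) := fun i j => abs_mul_le_mul_of_abs_le (hl i) (hX j)
  have hw : ∀ i j, t ^ (p j - p i) = t ^ (1 - p i) * t ^ (p j - 1) := fun i j => by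
    rw [← Real.rpow_add ht]; ring_nf
  have hηd : ∀ i j, ∃ G, HasDerivAt (fun s => kasnerFrame p η s i j) (G / t) t ∧
      |G| ≤ (305 * D + 146) * S := fun i j => by
    refine ⟨_, hasDerivAt_rpow_mul ht (h.eta_evol t ht i j), ?_⟩
    have e1 : t ^ (p j - p i) * t ^ (2 * p i - 2 * p j) = t ^ (p i - p j) := by
      rw [← Real.rpow_add ht]; ring_nf
    have e : (p j - p i) * (t ^ (p j - p i) * η t i j) + t ^ (p j - p i) *
        (κ t i j + 2 * (p i - p j) * η t i j - p i * (if i = j then 1 else 0) * ν t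
          - (1/2) * (lam i : ℝ) * X t j
          - (1/2) * t ^ (2 * p i - 2 * p j) * (lam j : ℝ) * X t i)
        = (p i - p j) * kasnerFrame p η t i j + kasnerFrame p κ t i j
          - p i * (if i = j then 1 else 0) * ν t
          - 1/2 * ((t ^ (1 - p i) * (lam i : ℝ)) * (t ^ (p j - 1) * X t j))
          - 1/2 * ((t ^ (1 - p j) * (lam j : ℝ)) * (t ^ (p i - 1) * X t i)) := by
      unfold kasnerFrame
      linear_combination -hδw i j - 1/2 * lam i * X t j * hw i j
        - 1/2 * lam j * X t i * (e1.trans (hw j i))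
    rw [e]
    have b1 := abs_le.1 (abs_mul_le_mul_of_abs_le (hd i j) (hη i j))
    have b2 := abs_le.1 (hκ i j)
    have b3 := abs_le.1 (hδ i j)
    have b4 := abs_le.1 (hlX i j)
    have b5 := abs_le.1 (hlX j i)
    rw [abs_le]
    constructor <;> linarith [b1.1, b1.2, b2.1, b2.2, b3.1, b3.2, b4.1, b4.2, b5.1, b5.2]
  have hκd : ∀ i j, ∃ G, HasDerivAt (fun s => kasnerFrame p κ s i j) (G / t) t ∧
      |G| ≤ (305 * D + 146) * S := fun i j => by
    refine ⟨_, hasDerivAt_rpow_mul ht (h.kappa_evol t ht i j), ?_⟩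
    have e1 : t ^ (p j - p i) * t ^ (2 - 2 * p j) = t ^ (1 - p i) * t ^ (1 - p j) := by
      rw [← Real.rpow_add ht, ← Real.rpow_add ht]; ring_nf
    have e : (p j - p i) * (t ^ (p j - p i) * κ t i j) + t ^ (p j - p i) *
        (-(tau p lam t ^ 2) * η t i j + t ^ (2 - 2 * p j) * (lam i : ℝ) * (lam j : ℝ) * ν t
          + p i * (if i = j then 1 else 0) * ν t + (p i - p j) * (lam i : ℝ) * X t j)
        = (p j - p i) * kasnerFrame p κ t i j - tau p lam t ^ 2 * kasnerFrame p η t i j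
          + (t ^ (1 - p i) * (lam i : ℝ)) * ((t ^ (1 - p j) * (lam j : ℝ)) * ν t)
          + p i * (if i = j then 1 else 0) * ν t
          + (p i - p j) * ((t ^ (1 - p i) * (lam i : ℝ)) * (t ^ (p j - 1) * X t j)) := by
      unfold kasnerFrame
      linear_combination hδw i j + (p i - p j) * lam i * X t j * hw i j
        + lam i * lam j * ν t * e1
    rw [e]
    have b1 := abs_le.1 (abs_mul_le_mul_of_abs_le (hd j i) (hκ i j))
    have b2 := abs_le.1 (abs_mul_le_mul_of_abs_le hτsq (hη i j))
    have b3 := abs_le.1 (abs_mul_le_mul_of_abs_le (hl i) (abs_mul_le_mul_of_abs_le (hl j) hν))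
    have b4 := abs_le.1 (hδ i j)
    have b5 := abs_le.1 (abs_mul_le_mul_of_abs_le (hd i j) (hlX i j))
    rw [abs_le]
    constructor <;> linarith [b1.1, b1.2, b2.1, b2.2, b3.1, b3.2, b4.1, b4.2, b5.1, b5.2]
  choose Gη hGη hGη' using hηd
  choose Gκ hGκ hGκ' using hκd
  have bp := abs_le.1 (abs_mul_le_mul_of_abs_le hpphi hν)
  have hφd : |ψ t + pphi * ν t| ≤ (305 * D + 146) * S := by
    have := abs_le.1 hψ
    rw [abs_le]
    constructor <;> linarith [bp.1, bp.2, this.1, this.2]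
  have hψd : |-(tau p lam t ^ 2) * φ t - pphi * ν t| ≤ (305 * D + 146) * S := by
    have := abs_le.1 (abs_mul_le_mul_of_abs_le hτsq hφ)
    rw [abs_le]
    constructor <;> linarith [bp.1, bp.2, this.1, this.2]
  refine ⟨(∑ i, ∑ j, (2 * (kasnerFrame p κ t i j * Gκ i j)
      + 2 * (kasnerFrame p η t i j * Gη i j)))
    + 2 * (ψ t * (-(tau p lam t ^ 2) * φ t - pphi * ν t)) + 2 * (φ t * (ψ t + pphi * ν t)),
    ?_, ?_⟩
  · have hev : Emid p η κ φ ψ =ᶠ[𝓝 t] fun s =>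
        (∑ i, ∑ j, (kasnerFrame p κ s i j ^ 2 + kasnerFrame p η s i j ^ 2))
          + ψ s ^ 2 + φ s ^ 2 := by
      filter_upwards [lt_mem_nhds ht] with s hs using Emid_eq_kasnerFrame hs
    refine HasDerivAt.congr_of_eventuallyEq ?_ hev
    have hder := ((HasDerivAt.fun_sum (u := Finset.univ) fun i _ =>
      HasDerivAt.fun_sum (u := Finset.univ) fun j _ =>
        ((hGκ i j).fun_pow 2).fun_add ((hGη i j).fun_pow 2)).fun_add
          ((h.psi_evol t ht).fun_pow 2)).fun_add ((h.phi_evol t ht).fun_pow 2)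
    convert hder using 1
    rw [add_div, add_div]
    simp only [Finset.sum_div]
    congr 1
    · congr 1
      · refine Finset.sum_congr rfl fun i _ => Finset.sum_congr rfl fun j _ => ?_
        push_cast; ring
      · push_cast; ring
    · push_cast; ring
  · have hs : |∑ i, ∑ j, (2 * (kasnerFrame p κ t i j * Gκ i j)
        + 2 * (kasnerFrame p η t i j * Gη i j))|
        ≤ D * (D * (4 * (S * ((305 * D + 146) * S)))) :=
      abs_sum_fin_le fun i => abs_sum_fin_le fun j => by
        have b1 := abs_le.1 (abs_mul_le_mul_of_abs_le (hκ i j) (hGκ' i j))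
        have b2 := abs_le.1 (abs_mul_le_mul_of_abs_le (hη i j) (hGη' i j))
        rw [abs_le]
        constructor <;> linarith [b1.1, b1.2, b2.1, b2.2]
    have b1 := abs_le.1 (abs_mul_le_mul_of_abs_le hψ hψd)
    have b2 := abs_le.1 (abs_mul_le_mul_of_abs_le hφ hφd)
    rw [← hSS]
    rw [abs_le] at hs ⊢
    constructor <;> linarith [b1.1, b1.2, b2.1, b2.2, hs.1, hs.2]

theorem IsCMCSHSolution.Emid_comparable (h : IsCMCSHSolution p pphi lam η κ φ ψ ν X)
    (hp : ∀ i, |p i| ≤ 1) (hpphi : |pphi| ≤ 1) {c : ℝ} (hc0 : 0 < c) (hc : ∀ i, p i ≤ 1 - c)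
    {a b : ℝ} (ha : 0 < a) (hab : a ≤ b) (hτa : 1 ≤ tau p lam a) (hτb : tau p lam b ≤ 4) :
    Emid p η κ φ ψ b
        ≤ 16 ^ ((4 * D ^ 2 + 4) * (305 * D + 146) / (2 * c) : ℝ) * Emid p η κ φ ψ a ∧
      Emid p η κ φ ψ a
        ≤ 16 ^ ((4 * D ^ 2 + 4) * (305 * D + 146) / (2 * c) : ℝ) * Emid p η κ φ ψ b := by
  have hb := ha.trans_le hab
  have hp1 : ∀ i, p i ≤ 1 := fun i => (abs_le.1 (hp i)).2
  set C : ℝ := (4 * D ^ 2 + 4) * (305 * D + 146) with hC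
  have hC0 : 0 ≤ C := by positivity
  have hex : ∀ t, ∃ G, t ∈ Set.Icc a b → HasDerivAt (Emid p η κ φ ψ) (G / t) t ∧
      |G| ≤ C * Emid p η κ φ ψ t := fun t => by
    by_cases ht : t ∈ Set.Icc a b
    · obtain ⟨G, hG⟩ := h.exists_deriv_Emid hp hpphi (ha.trans_le ht.1)
        (hτa.trans (tau_le_tau hp1 lam ha ht.1))
        ((tau_le_tau hp1 lam (ha.trans_le ht.1) ht.2).trans hτb)
      exact ⟨G, fun _ => hG⟩
    · exact ⟨0, fun hcon => absurd hcon ht⟩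
  choose G hG using hex
  have hgron := le_rpow_mul_of_abs_deriv_le ha hab (fun t ht => (hG t ht).1)
    fun t ht => (hG t ht).2
  have hratio : (b / a) ^ (2 * c) ≤ 16 := by
    have h1 := rpow_mul_tau_sq_le hc lam ha hab
    have h2 : 0 ≤ (b / a) ^ (2 * c) := by positivity
    nlinarith [mul_le_mul_of_nonneg_left (show 1 ≤ tau p lam a ^ 2 by nlinarith) h2,
      show 0 ≤ tau p lam b from Real.sqrt_nonneg _]
  have hR : (b / a) ^ C ≤ 16 ^ (C / (2 * c)) := by
    have h1 := Real.rpow_le_rpow (by positivity) hratio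
      (by positivity : 0 ≤ C / (2 * c))
    rwa [← Real.rpow_mul (by positivity), mul_div_cancel₀ _ (by positivity)] at h1
  exact ⟨hgron.1.trans (mul_le_mul_of_nonneg_right hR (Emid_nonneg ha)),
    hgron.2.trans (mul_le_mul_of_nonneg_right hR (Emid_nonneg hb))⟩

end Solution

/-- Proposition `prop:mid_freq`: the mid-frequency energy estimate connecting the
high- and low-frequency regimes, for τ̊ as in the coercivity of the high-frequency
Einstein energy; t_{τ̊} is the unique time with τ(t_{τ̊}) = τ̊ and t_{λ*} the unique
time with τ(t_{λ*}) = 1 (note E_mid(t_{λ*}) equals the low-frequency energy there). -/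
theorem einstein_mid_freq_energy_estimate (D : ℕ) (hD : 2 ≤ D)
    (p : Fin D → ℝ) (pphi : ℝ)
    (hkas1 : ∑ i, p i = 1) (hkas2 : (∑ i, p i ^ 2) + 2 * pphi ^ 2 = 1)
    (hp : ∀ i, p i < 1) :
    ∃ taumid : ℝ, 1 ≤ taumid ∧ ∃ Cmid : ℝ, 0 < Cmid ∧
      ∀ (lam : Fin D → ℤ), lam ≠ 0 →
      ∀ tstar : ℝ, 0 < tstar → tstar ≤ 1 → tau p lam tstar = 1 →
      ∀ (η κ : ℝ → Fin D → Fin D → ℝ) (φ ψ ν : ℝ → ℝ) (X : ℝ → Fin D → ℝ),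
        IsCMCSHSolution p pphi lam η κ φ ψ ν X →
      ∀ ttau : ℝ, 0 < ttau → tau p lam ttau = taumid →
        (∀ t : ℝ, 0 < t → 1 ≤ tau p lam t → tau p lam t ≤ taumid →
          Cmid⁻¹ * Emid p η κ φ ψ t ≤ Emid p η κ φ ψ ttau ∧
          Emid p η κ φ ψ ttau ≤ Cmid * Emid p η κ φ ψ t) ∧
        (Cmid⁻¹ * Emid p η κ φ ψ tstar ≤ EsysHigh p lam η κ φ ψ ttau ∧
          EsysHigh p lam η κ φ ψ ttau ≤ Cmid * Emid p η κ φ ψ tstar) := by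
  have hp1 : ∀ i, |p i| ≤ 1 := fun i => by
    have h1 := Finset.single_le_sum (f := fun i => p i ^ 2) (fun _ _ => sq_nonneg _)
      (Finset.mem_univ i)
    exact (sq_le_one_iff_abs_le_one _).1 (by nlinarith [sq_nonneg pphi])
  have hpphi : |pphi| ≤ 1 := by
    have h1 : 0 ≤ ∑ i, p i ^ 2 := by positivity
    exact (sq_le_one_iff_abs_le_one _).1 (by nlinarith [sq_nonneg pphi])
  obtain ⟨c, hc0, hc⟩ : ∃ c : ℝ, 0 < c ∧ ∀ i, p i ≤ 1 - c := by
    have : Nonempty (Fin D) := ⟨⟨0, by omega⟩⟩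
    obtain ⟨m, hm⟩ := Finite.exists_max p
    exact ⟨1 - p m, by linarith [hp m], fun i => by linarith [hm i]⟩
  set R : ℝ := 16 ^ ((4 * D ^ 2 + 4) * (305 * D + 146) / (2 * c) : ℝ) with hR
  have hR0 : 0 < R := by positivity
  set K : ℝ := 10 * (1 / c) ^ 2 + 1 with hK
  have hK0 : 0 < K := by positivity
  refine ⟨4, by norm_num, (64 + K) * R, by positivity, ?_⟩
  intro lam _ tstar hts _ hτs η κ φ ψ ν X h ttau htt hτt
  have hcomp : ∀ t, 0 < t → 1 ≤ tau p lam t → tau p lam t ≤ 4 →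
      Emid p η κ φ ψ t ≤ R * Emid p η κ φ ψ ttau ∧
      Emid p η κ φ ψ ttau ≤ R * Emid p η κ φ ψ t := by
    intro t ht h1 h4
    rcases le_total t ttau with hle | hle
    · exact (h.Emid_comparable hp1 hpphi hc0 hc ht hle h1 hτt.le).symm
    · exact h.Emid_comparable hp1 hpphi hc0 hc htt hle (by rw [hτt]; norm_num) h4
  have hCpos : 0 < (64 + K) * R := by positivity
  refine ⟨fun t ht h1 h4 => ?_, ?_⟩
  · obtain ⟨hA, hB⟩ := hcomp t ht h1 h4
    have hE := mul_nonneg hR0.le (Emid_nonneg (p := p) (η := η) (κ := κ) (φ := φ) (ψ := ψ) ht)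
    have hE' := mul_nonneg hR0.le (Emid_nonneg (p := p) (η := η) (κ := κ) (φ := φ) (ψ := ψ) htt)
    constructor
    · rw [inv_mul_le_iff₀ hCpos]
      nlinarith [mul_nonneg hK0.le hE']
    · nlinarith [mul_nonneg hK0.le hE]
  · obtain ⟨hA, hB⟩ := hcomp tstar hts hτs.ge (by rw [hτs]; norm_num)
    obtain ⟨hL, hU⟩ := h.EsysHigh_bounds hp1 hc0 hc htt hτt
    have hE := mul_nonneg hR0.le (Emid_nonneg (p := p) (η := η) (κ := κ) (φ := φ) (ψ := ψ) hts)
    have hH : 0 ≤ EsysHigh p lam η κ φ ψ ttau :=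
      le_trans (mul_nonneg (by norm_num) (Emid_nonneg htt)) hL
    constructor
    · rw [inv_mul_le_iff₀ hCpos]
      nlinarith [mul_le_mul_of_nonneg_left hL hR0.le, mul_nonneg hK0.le (mul_nonneg hR0.le hH)]
    · nlinarith [mul_le_mul_of_nonneg_left hB hK0.le]
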